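/- arXiv:2601.10456 — 12 statements merged into one kernel-verified Lean document; each statement's English description precedes it below -/
import Mathlib

section
/- Let M be a set, s a map assigning to each x ∈ M a map s_x : M → M, and S : M × M × M → ℝ a function satisfying: (i) S(x,y,z) = S(z,x,y) and S(x,y,z) = −S(y,x,z) for all x,y,z; (ii) S(x, s_x(y), z) = −S(x,y,z) for all x,y,z; (iii) the cocycle condition S(m,x,y) + S(m,y,z) + S(m,z,x) = S(x,y,z) for all m,x,y,z. Suppose a,b,c,d,g ∈ M satisfy the barycenter condition S(a,b,g) + S(g,c,d) = S(a,g,d) + S(g,b,c). Then for every t ∈ M one has S(a,b,t) + S(t,c,d) = S(a, s_g(t), d) + S(s_g(t), b, c). -/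
/-- Admissibility and the cocycle condition imply that an `S`-barycenter `g` of
a quadruple `(a,b,c,d)` exchanges the two ways of composing:
`S(a,b,t) + S(t,c,d) = S(a, s_g t, d) + S(s_g t, b, c)` for every `t`. -/
theorem stmt_1 {M : Type*} (s : M → M → M) (S : M → M → M → ℝ)
    (hcyc : ∀ x y z, S x y z = S z x y)
    (hskew : ∀ x y z, S x y z = -S y x z)
    (hrefl : ∀ x y z, S x (s x y) z = -S x y z)
    (hcocycle : ∀ m x y z, S m x y + S m y z + S m z x = S x y z)
    (a b c d g : M)
    (hbar : S a b g + S g c d = S a g d + S g b c) :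
    ∀ t : M, S a b t + S t c d = S a (s g t) d + S (s g t) b c := by
  intro t
  have anti : ∀ x y, S g x y = -S g y x := fun x y => by
    rw [hcyc g x y, hskew y g x]
  have h1 : S a b g = S g a b := hcyc a b g
  have h2 : S a g d = -S g a d := hskew a g d
  rw [h1, h2] at hbar
  rw [← hcocycle g a b t, ← hcocycle g t c d, ← hcocycle g a (s g t) d,
    ← hcocycle g (s g t) b c]
  rw [anti a (s g t), anti c (s g t)]
  simp only [hrefl]
  linarith [anti b t, anti d t, anti a d]
end

section
/- Let M be a path-connected topological space and S : M × M × M → ℝ a continuous function satisfying S(x,y,z) = S(z,x,y) and S(x,y,z) = −S(y,x,z) for all x,y,z ∈ M. Then for every quadruple of points a,b,c,d ∈ M there exists a point g ∈ M (which may be chosen on any continuous path from a to c) such that S(a,b,g) + S(g,c,d) = S(a,g,d) + S(g,b,c); that is, an S-barycenter of (a,b,c,d) exists. -/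
/-- Existence of `S`-barycenters: on a path-connected space, if `S` is a
continuous three-point function which is cyclic and antisymmetric, then every
quadruple `(a,b,c,d)` admits a barycenter, which can moreover be chosen on any
continuous path from `a` to `c`. -/
theorem stmt_2 {M : Type*} [TopologicalSpace M] [PathConnectedSpace M]
    (S : M → M → M → ℝ)
    (hcont : Continuous fun p : M × M × M => S p.1 p.2.1 p.2.2)
    (hcyc : ∀ x y z, S x y z = S z x y)
    (hskew : ∀ x y z, S x y z = -S y x z) :
    ∀ a b c d : M,
      (∃ g : M, S a b g + S g c d = S a g d + S g b c) ∧
      (∀ γ : Path a c, ∃ t : unitInterval,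
        S a b (γ t) + S (γ t) c d = S a (γ t) d + S (γ t) b c) := by
  intro a b c d
  have h0 : ∀ x y, S x x y = 0 := fun x y => by linarith [hskew x x y]
  have h1 : ∀ x y, S x y x = 0 := fun x y => by rw [hcyc, h0]
  have key : ∀ γ : Path a c, ∃ t : unitInterval,
      S a b (γ t) + S (γ t) c d = S a (γ t) d + S (γ t) b c := by
    intro γ
    have c1 : Continuous fun t : unitInterval => S a b (γ t) :=
      hcont.comp (f := fun t : unitInterval => (a, b, γ t)) (by fun_prop)
    have c2 : Continuous fun t : unitInterval => S (γ t) c d :=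
      hcont.comp (f := fun t : unitInterval => (γ t, c, d)) (by fun_prop)
    have c3 : Continuous fun t : unitInterval => S a (γ t) d :=
      hcont.comp (f := fun t : unitInterval => (a, γ t, d)) (by fun_prop)
    have c4 : Continuous fun t : unitInterval => S (γ t) b c :=
      hcont.comp (f := fun t : unitInterval => (γ t, b, c)) (by fun_prop)
    rcases le_total (S a c d) (S a b c) with h | h
    · exact mem_range_of_exists_le_of_exists_ge
        (f := fun t => S a b (γ t) + S (γ t) c d - (S a (γ t) d + S (γ t) b c)) (c := 0)
        ((c1.add c2).sub (c3.add c4))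
        ⟨0, by simp [h0, h1]; linarith⟩ ⟨1, by simp [h0, h1]; linarith⟩
        |>.imp fun t ht => sub_eq_zero.mp ht
    · exact mem_range_of_exists_le_of_exists_ge
        (f := fun t => S a b (γ t) + S (γ t) c d - (S a (γ t) d + S (γ t) b c)) (c := 0)
        ((c1.add c2).sub (c3.add c4))
        ⟨1, by simp [h0, h1]; linarith⟩ ⟨0, by simp [h0, h1]; linarith⟩
        |>.imp fun t ht => sub_eq_zero.mp ht
  obtain ⟨t, ht⟩ := key (PathConnectedSpace.somePath a c)
  exact ⟨⟨_, ht⟩, key⟩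
end

section
/- Let M be a set with a family of bijections s_x : M → M (x ∈ M) satisfying s_x ∘ s_x = id and s_x ∘ s_y ∘ s_x = s_{s_x(y)} for all x,y ∈ M. Fix o ∈ M and a midpoint map h : M → M with s_{h(x)}(o) = x for all x ∈ M. Let u : M × M → ℝ satisfy: (K) u(φ(x), φ(y)) = u(x,y) for every bijection φ : M → M with φ(o) = o and φ ∘ s_x = s_{φ(x)} ∘ φ for all x; (skew) u(x,y) = −u(y,x); (b) u(s_o(x), y) = −u(x,y); (c) u(x, s_{h(x)}(y)) = −u(x,y) for all x,y. Define S(x,y,z) := u(s_{h(x)}(y), s_{h(x)}(z)). Then S satisfies: S(x,y,z) = S(z,x,y), S(x,y,z) = −S(z,y,x), S(s_w(x), s_w(y), s_w(z)) = S(x,y,z) for all w, and S(x, s_x(y), z) = −S(x,y,z); that is, S is an admissible three-point function. -/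
/-- From a two-point admissible function `u` on a symmetric space with base
point `o` and midpoint map `h` (`s_{h x} o = x`), the three-point function
`S(x,y,z) := u(s_{h x} y, s_{h x} z)` is admissible: cyclic, antisymmetric,
invariant under all symmetries, and satisfying `S(x, s_x y, z) = −S(x,y,z)`. -/
theorem stmt_4 {M : Type*} (s : M → M → M)
    (hs1 : ∀ x y, s x (s x y) = y)
    (hs2 : ∀ x y z, s x (s y (s x z)) = s (s x y) z)
    (o : M) (h : M → M) (hmid : ∀ x, s (h x) o = x)
    (u : M → M → ℝ)
    (hK : ∀ φ : M → M, Function.Bijective φ → φ o = o →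
      (∀ x y, φ (s x y) = s (φ x) (φ y)) → ∀ x y, u (φ x) (φ y) = u x y)
    (hskew : ∀ x y, u x y = -u y x)
    (hb : ∀ x y, u (s o x) y = -u x y)
    (hc : ∀ x y, u x (s (h x) y) = -u x y)
    (S : M → M → M → ℝ)
    (hS : ∀ x y z, S x y z = u (s (h x) y) (s (h x) z)) :
    (∀ x y z, S x y z = S z x y) ∧
    (∀ x y z, S x y z = -S z y x) ∧
    (∀ w x y z, S (s w x) (s w y) (s w z) = S x y z) ∧
    (∀ x y z, S x (s x y) z = -S x y z) := by
  have aut : ∀ w x y, s w (s x y) = s (s w x) (s w y) := by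
    intro w x y
    have := hs2 w x (s w y)
    rwa [hs1] at this
  have bij : ∀ w, Function.Bijective (s w) := fun w =>
    Function.Involutive.bijective (hs1 w)
  have mid2 : ∀ x, s (h x) x = o := by
    intro x
    have := hs1 (h x) o
    rwa [hmid] at this
  have inv : ∀ w x y z, S (s w x) (s w y) (s w z) = S x y z := by
    intro w x y z
    have key := hK (fun a => s (h (s w x)) (s w (s (h x) a)))
      ((bij _).comp ((bij _).comp (bij _)))
      (by simp only [hmid, mid2])
      (by
        intro a b
        rw [aut (h x) a b, aut w, aut (h (s w x))])
      (s (h x) y) (s (h x) z)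
    simp only [hs1] at key
    rw [hS, hS, key]
  have skew : ∀ x y z, S x y z = -S x z y := by
    intro x y z
    rw [hS, hS, hskew]
  have So : ∀ y z, S o y z = u y z := by
    intro y z
    rw [hS]
    exact hK (s (h o)) (bij _) (hmid o) (aut _) y z
  have Sxo : ∀ x z, S x o z = -S o x z := by
    intro x z
    rw [hS, hmid, hc, So]
  have swap : ∀ x y z, S x y z = -S y x z := by
    intro x y z
    rw [← inv (h y) x y z, ← inv (h y) y x z, mid2, Sxo]
  refine ⟨?_, ?_, inv, ?_⟩
  · intro x y z
    rw [skew x y z, swap x z y, neg_neg]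
  · intro x y z
    rw [skew x y z, swap x z y, skew z x y, neg_neg]
  · intro x y z
    have e : s (h x) (s x y) = s o (s (h x) y) := by
      rw [aut, mid2]
    rw [hS, hS, e, hb]
end

section
/- Let S be the ax+b group, i.e. ℝ² with multiplication (a,n)·(a',n') = (a+a', e^{−2a'}n + n'), unit (0,0) and inverse (a,n)⁻¹ = (−a, −e^{2a}n). For κ ≥ 0 define s^{(κ)}_e(a,n) := (−a − (1/2)·log(1+κn²), −n) and s^{(κ)}_x := L_x ∘ s^{(κ)}_e ∘ L_{x⁻¹}, where L_x denotes left translation by x. Then for every x, y ∈ S: (a) s^{(κ)}_x ∘ s^{(κ)}_x = id; (b) x is the unique fixed point of s^{(κ)}_x; (c) s^{(κ)}_x ∘ s^{(κ)}_y ∘ s^{(κ)}_x = s^{(κ)}_{s^{(κ)}_x(y)}; (d) each s^{(κ)}_x preserves the Lebesgue measure on ℝ². Hence s^{(κ)} defines a one-parameter family of symplectic symmetric space structures on (S, da∧dn). -/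
open MeasureTheory

theorem aux_mp_L (x : ℝ × ℝ) : MeasurePreserving
    (fun q : ℝ × ℝ => (x.1 + q.1, Real.exp (-(2 * q.1)) * x.2 + q.2))
    (volume : Measure (ℝ × ℝ)) volume := by
  have h := (measurePreserving_add_left (volume : Measure ℝ) x.1).skew_product
    (μc := (volume : Measure ℝ)) (μd := (volume : Measure ℝ))
    (g := fun a n => Real.exp (-(2 * a)) * x.2 + n) (by fun_prop)
    (Filter.Eventually.of_forall fun a => (measurePreserving_add_left volume _).map_eq)
  exact h

theorem aux_mp_se (κ : ℝ) : MeasurePreserving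
    (fun p : ℝ × ℝ => (-p.1 - (1 / 2) * Real.log (1 + κ * p.2 ^ 2), -p.2))
    (volume : Measure (ℝ × ℝ)) volume := by
  have h := (Measure.measurePreserving_neg (volume : Measure ℝ)).skew_product
    (μc := (volume : Measure ℝ)) (μd := (volume : Measure ℝ))
    (g := fun n a => -a - (1 / 2) * Real.log (1 + κ * n ^ 2)) (by
      simp only [Function.uncurry_def]
      fun_prop)
    (Filter.Eventually.of_forall fun n =>
      ((measurePreserving_sub_right volume _).comp
        (Measure.measurePreserving_neg (volume : Measure ℝ))).map_eq)
  exact (Measure.measurePreserving_swap.comp h).comp Measure.measurePreserving_swap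

/-- The rational form of the symmetry, in coordinates `(e^{2a}, e^{2a} n)`. -/
theorem aux_c (κ A p B q C r : ℝ) (hκ : 0 ≤ κ) (hA : 0 < A) (hB : 0 < B) (hC : 0 < C)
    (C1 r1 C2 r2 C3 r3 B1 q1 C4 r4 : ℝ)
    (hC1 : C1 = A ^ 2 * C / (C ^ 2 + κ * (r - p) ^ 2))
    (hr1 : r1 = p - A ^ 2 * (r - p) / (C ^ 2 + κ * (r - p) ^ 2))
    (hC2 : C2 = B ^ 2 * C1 / (C1 ^ 2 + κ * (r1 - q) ^ 2))
    (hr2 : r2 = q - B ^ 2 * (r1 - q) / (C1 ^ 2 + κ * (r1 - q) ^ 2))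
    (hC3 : C3 = A ^ 2 * C2 / (C2 ^ 2 + κ * (r2 - p) ^ 2))
    (hr3 : r3 = p - A ^ 2 * (r2 - p) / (C2 ^ 2 + κ * (r2 - p) ^ 2))
    (hB1 : B1 = A ^ 2 * B / (B ^ 2 + κ * (q - p) ^ 2))
    (hq1 : q1 = p - A ^ 2 * (q - p) / (B ^ 2 + κ * (q - p) ^ 2))
    (hC4 : C4 = B1 ^ 2 * C / (C ^ 2 + κ * (r - q1) ^ 2))
    (hr4 : r4 = q1 - B1 ^ 2 * (r - q1) / (C ^ 2 + κ * (r - q1) ^ 2)) :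
    C3 = C4 ∧ r3 = r4 := by
  obtain ⟨u, rfl⟩ : ∃ u, r = p + u := ⟨r - p, by ring⟩
  obtain ⟨v, rfl⟩ : ∃ v, q = p + v := ⟨q - p, by ring⟩
  simp only [add_sub_cancel_left] at *
  have hN : 0 < C ^ 2 + κ * u ^ 2 := by positivity
  have hQ : 0 < B ^ 2 + κ * v ^ 2 := by positivity
  have hC1p : 0 < C1 := by rw [hC1]; positivity
  have hD1 : 0 < C1 ^ 2 + κ * (r1 - (p + v)) ^ 2 := by positivity
  have hC2p : 0 < C2 := by rw [hC2]; positivity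
  have hD2 : 0 < C2 ^ 2 + κ * (r2 - p) ^ 2 := by positivity
  have hD4 : 0 < C ^ 2 + κ * (p + u - q1) ^ 2 := by positivity
  set N := C ^ 2 + κ * u ^ 2 with hNd
  set Q := B ^ 2 + κ * v ^ 2 with hQd
  set M := A ^ 4 + 2 * κ * A ^ 2 * u * v + κ * v ^ 2 * N with hM
  have e1 : C1 ^ 2 + κ * (r1 - (p + v)) ^ 2 = M / N := by
    rw [hC1, hr1, hM]; field_simp; rw [hNd]; ring
  have hMp : 0 < M := by
    rw [e1] at hD1
    exact (div_pos_iff_of_pos_right hN).1 hD1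
  rw [e1] at hC2 hr2
  have hC2' : C2 = A ^ 2 * B ^ 2 * C / M := by
    rw [hC2, hC1]; field_simp
  have hr2' : r2 = p + (v * M + B ^ 2 * (A ^ 2 * u + v * N)) / M := by
    rw [hr2, hr1]; field_simp; ring
  set K := A ^ 4 * B ^ 4 * C ^ 2 + κ * (v * M + B ^ 2 * (A ^ 2 * u + v * N)) ^ 2 with hK
  set T := Q ^ 2 * C ^ 2 + κ * (Q * u + A ^ 2 * v) ^ 2 with hT
  have e2 : C2 ^ 2 + κ * (r2 - p) ^ 2 = K / M ^ 2 := by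
    rw [hC2', hr2', hK]; field_simp; ring
  have e4 : C ^ 2 + κ * (p + u - q1) ^ 2 = T / Q ^ 2 := by
    rw [hq1, hT]; field_simp; ring
  have hKT : K = M * T := by
    rw [hK, hT, hM, hNd, hQd]; ring
  have hTp : 0 < T := by
    rw [e4] at hD4
    exact (div_pos_iff_of_pos_right (by positivity)).1 hD4
  rw [e2, hKT] at hC3 hr3
  rw [e4] at hC4 hr4
  constructor
  · rw [hC3, hC4, hC2', hB1]; field_simp
  · rw [hr3, hr4, hr2', hB1, hq1]; field_simp
    rw [hT, hM, hQd, hNd]; ring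

/-- On the `ax+b` group `ℝ²` with law `(a,n)·(a',n') = (a+a', e^{−2a'}n+n')`,
the maps `s^{(κ)}_x := L_x ∘ s^{(κ)}_e ∘ L_{x⁻¹}` with
`s^{(κ)}_e(a,n) = (−a − ½log(1+κn²), −n)` (κ ≥ 0) are involutive, have `x` as
unique fixed point, satisfy the symmetric space identity
`s_x ∘ s_y ∘ s_x = s_{s_x y}`, and preserve the Lebesgue measure. -/
theorem stmt_6 (κ : ℝ) (hκ : 0 ≤ κ)
    (mul : ℝ × ℝ → ℝ × ℝ → ℝ × ℝ)
    (hmul : ∀ p q, mul p q = (p.1 + q.1, Real.exp (-(2 * q.1)) * p.2 + q.2))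
    (inv : ℝ × ℝ → ℝ × ℝ)
    (hinv : ∀ p, inv p = (-p.1, -(Real.exp (2 * p.1) * p.2)))
    (se : ℝ × ℝ → ℝ × ℝ)
    (hse : ∀ p, se p = (-p.1 - (1 / 2) * Real.log (1 + κ * p.2 ^ 2), -p.2))
    (s : ℝ × ℝ → ℝ × ℝ → ℝ × ℝ)
    (hs : ∀ x y, s x y = mul x (se (mul (inv x) y))) :
    ∀ x y : ℝ × ℝ,
      (∀ z, s x (s x z) = z) ∧
      (s x x = x ∧ ∀ z, s x z = z → z = x) ∧
      (∀ z, s x (s y (s x z)) = s (s x y) z) ∧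
      MeasurePreserving (s x) (volume : Measure (ℝ × ℝ)) volume := by
  have hLmp : ∀ x, MeasurePreserving (mul x) (volume : Measure (ℝ × ℝ)) volume := by
    intro x
    have : mul x = fun q => (x.1 + q.1, Real.exp (-(2 * q.1)) * x.2 + q.2) := funext (hmul x)
    rw [this]; exact aux_mp_L x
  have hsemp : MeasurePreserving se (volume : Measure (ℝ × ℝ)) volume := by
    have : se = _ := funext hse
    rw [this]; exact aux_mp_se κ
  have hli : ∀ x y, mul (inv x) (mul x y) = y := by
    intro x y
    simp only [hmul, hinv]
    ext
    · simp
    · simp only [mul_neg, neg_mul, ← mul_assoc, ← Real.exp_add]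
      ring_nf
  have hri : ∀ x y, mul x (mul (inv x) y) = y := by
    intro x y
    simp only [hmul, hinv]
    ext
    · simp
    · simp only [mul_neg, neg_mul, ← mul_assoc, ← Real.exp_add]
      ring_nf
  have hsese : ∀ z, se (se z) = z := by
    intro z
    simp only [hse]
    ext <;> simp
  have hE : ∀ x z, Real.exp (2 * (s x z).1) = Real.exp (2 * x.1) ^ 2 * Real.exp (2 * z.1) /
        (Real.exp (2 * z.1) ^ 2 +
          κ * (Real.exp (2 * z.1) * z.2 - Real.exp (2 * x.1) * x.2) ^ 2) ∧
      Real.exp (2 * (s x z).1) * (s x z).2 = Real.exp (2 * x.1) * x.2 - Real.exp (2 * x.1) ^ 2 *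
        (Real.exp (2 * z.1) * z.2 - Real.exp (2 * x.1) * x.2) /
        (Real.exp (2 * z.1) ^ 2 +
          κ * (Real.exp (2 * z.1) * z.2 - Real.exp (2 * x.1) * x.2) ^ 2) := by
    rintro ⟨a, n⟩ ⟨b, m⟩
    simp only [hs, hmul, hinv, hse]
    set w := Real.exp (-(2 * b)) * -(Real.exp (2 * a) * n) + m with hw
    have hA := Real.exp_pos (2 * a)
    have hB := Real.exp_pos (2 * b)
    have hW : 0 < 1 + κ * w ^ 2 := by positivity
    have hw' : Real.exp (2 * b) * m - Real.exp (2 * a) * n = Real.exp (2 * b) * w := by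
      rw [hw, Real.exp_neg]; field_simp; ring
    have h1 : Real.exp (2 * (a + (-(-a + b) - 1 / 2 * Real.log (1 + κ * w ^ 2)))) =
        Real.exp (2 * a) ^ 2 / (Real.exp (2 * b) * (1 + κ * w ^ 2)) := by
      have : 2 * (a + (-(-a + b) - 1 / 2 * Real.log (1 + κ * w ^ 2))) =
        2 * a + 2 * a - (2 * b + Real.log (1 + κ * w ^ 2)) := by ring
      rw [this, Real.exp_sub, Real.exp_add, Real.exp_add, Real.exp_log hW, sq (Real.exp (2 * a))]
    have h2 : Real.exp (-(2 * (-(-a + b) - 1 / 2 * Real.log (1 + κ * w ^ 2)))) =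
        Real.exp (2 * b) * (1 + κ * w ^ 2) / Real.exp (2 * a) := by
      have : -(2 * (-(-a + b) - 1 / 2 * Real.log (1 + κ * w ^ 2))) =
        2 * b + Real.log (1 + κ * w ^ 2) - 2 * a := by ring
      rw [this, Real.exp_sub, Real.exp_add, Real.exp_log hW]
    have h3 : Real.exp (2 * b) ^ 2 + κ * (Real.exp (2 * b) * w) ^ 2 =
        Real.exp (2 * b) ^ 2 * (1 + κ * w ^ 2) := by ring
    rw [h1, h2, hw', h3]
    clear_value w
    constructor
    · field_simp
    · field_simp
      try ring
  intro x y
  refine ⟨?_, ⟨?_, ?_⟩, ?_, ?_⟩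
  · intro z
    rw [hs x (s x z), hs x z, hli, hsese, hri]
  · simp only [hs, hmul, hinv, hse]
    ext
    · simp [← Real.exp_add, ← mul_assoc, ← Real.exp_neg]
    · simp [← Real.exp_add, ← mul_assoc, ← Real.exp_neg]
  · intro z hz
    have h1 : se (mul (inv x) z) = mul (inv x) z := by
      rw [hs] at hz
      conv_rhs => rw [← hz]
      rw [hli]
    have h0 : mul (inv x) z = (0, 0) := by
      rw [hse] at h1
      have ha := congrArg Prod.fst h1
      have hb := congrArg Prod.snd h1
      simp only at ha hb
      have hb' : (mul (inv x) z).2 = 0 := by linarith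
      rw [hb'] at ha
      simp at ha
      ext
      · simp only; linarith
      · exact hb'
    have := hri x z
    rw [h0, hmul] at this
    rw [← this]
    simp
  · intro z
    obtain ⟨h1, h2⟩ := aux_c κ (Real.exp (2 * x.1)) (Real.exp (2 * x.1) * x.2)
      (Real.exp (2 * y.1)) (Real.exp (2 * y.1) * y.2)
      (Real.exp (2 * z.1)) (Real.exp (2 * z.1) * z.2) hκ
      (Real.exp_pos _) (Real.exp_pos _) (Real.exp_pos _) _ _ _ _ _ _ _ _ _ _
      (hE x z).1 (hE x z).2 (hE y (s x z)).1 (hE y (s x z)).2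
      (hE x (s y (s x z))).1 (hE x (s y (s x z))).2 (hE x y).1 (hE x y).2
      (hE (s x y) z).1 (hE (s x y) z).2
    rw [h1] at h2
    ext
    · have := Real.exp_injective h1
      linarith
    · exact mul_left_cancel₀ (Real.exp_pos _).ne' h2
  · have : s x = mul x ∘ se ∘ mul (inv x) := funext (hs x)
    rw [this]
    exact (hLmp x).comp (hsemp.comp (hLmp (inv x)))
end

section
/- Let S be the ax+b group, i.e. ℝ² with multiplication (a,n)·(a',n') = (a+a', e^{−2a'}n + n'), and define ψ : ℝ² → S by ψ(a,n) := (a,0)·(0,n)·(a,0) = (2a, e^{−2a}n). Define s_{(a,n)}(a',n') := (2a − a', 2·cosh(2(a−a'))·n − n'). Then for all x = (a,n) and y = (a',n') in ℝ² one has ψ(s_x(y)) = ψ(x)·ψ(y)⁻¹·ψ(x); i.e. under the diffeomorphism ψ the canonical Lie group symmetric space structure ŝ_x(y) = x·y⁻¹·x on S is given by the explicit formula s_{(a,n)}(a',n') = (2a−a', 2cosh(2(a−a'))n − n'). -/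
/-- Under the diffeomorphism `ψ(a,n) = (a,0)·(0,n)·(a,0) = (2a, e^{−2a}n)` of
the `ax+b` group, the canonical Lie group symmetric space structure
`ŝ_x(y) = x·y⁻¹·x` is given by the explicit formula
`s_{(a,n)}(a',n') = (2a−a', 2cosh(2(a−a'))n − n')`. -/
theorem stmt_7
    (mul : ℝ × ℝ → ℝ × ℝ → ℝ × ℝ)
    (hmul : ∀ p q, mul p q = (p.1 + q.1, Real.exp (-(2 * q.1)) * p.2 + q.2))
    (inv : ℝ × ℝ → ℝ × ℝ)
    (hinv : ∀ p, inv p = (-p.1, -(Real.exp (2 * p.1) * p.2)))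
    (ψ : ℝ × ℝ → ℝ × ℝ)
    (hψ : ∀ p, ψ p = mul (mul (p.1, 0) (0, p.2)) (p.1, 0))
    (s : ℝ × ℝ → ℝ × ℝ → ℝ × ℝ)
    (hs : ∀ x y, s x y = (2 * x.1 - y.1, 2 * Real.cosh (2 * (x.1 - y.1)) * x.2 - y.2)) :
    (∀ p : ℝ × ℝ, ψ p = (2 * p.1, Real.exp (-(2 * p.1)) * p.2)) ∧
    (∀ x y : ℝ × ℝ, ψ (s x y) = mul (mul (ψ x) (inv (ψ y))) (ψ x)) := by
  have h1 : ∀ p : ℝ × ℝ, ψ p = (2 * p.1, Real.exp (-(2 * p.1)) * p.2) := by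
    intro p
    rw [hψ, hmul, hmul]
    ext
    · simp; ring
    · simp
  refine ⟨h1, ?_⟩
  rintro ⟨a, n⟩ ⟨b, m⟩
  rw [h1, hs, hmul, hmul, hinv, h1, h1]
  ext
  · simp only; ring
  · simp only [Real.cosh_eq]
    have e1 : Real.exp (-(2 * (2 * a - b))) * Real.exp (2 * (a - b)) = Real.exp (-(2 * a)) := by
      rw [← Real.exp_add]; congr 1; ring
    have e2 : Real.exp (-(2 * (2 * a - b))) * Real.exp (-(2 * (a - b)))
        = Real.exp (-(2 * (2 * a))) * Real.exp (-(2 * -(2 * b))) * Real.exp (-(2 * a)) := by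
      rw [← Real.exp_add, ← Real.exp_add, ← Real.exp_add]; congr 1; ring
    have e3 : Real.exp (-(2 * (2 * a - b)))
        = Real.exp (-(2 * (2 * a))) * Real.exp (2 * (2 * b)) * Real.exp (-(2 * b)) := by
      rw [← Real.exp_add, ← Real.exp_add]; congr 1; ring
    linear_combination n * e1 + n * e2 - m * e3
end

section
/- Define on ℝ² the maps s_{(a,n)}(a',n') := (2a − a', 2·cosh(2(a−a'))·n − n'), and let m(x,y) := ((a_x+a_y)/2, (n_x+n_y)/(2·cosh(a_x−a_y))) be the associated midpoint map, so that s_{m(x,y)}(x) = y. Then the map Φ : (ℝ²)³ → (ℝ²)³ defined by Φ(x,y,z) := (m(x,y), m(y,z), m(z,x)) is a bijection. -/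
/-- For the symmetric space structure
`s_{(a,n)}(a',n') = (2a−a', 2cosh(2(a−a'))n − n')` on `ℝ²` with midpoint map
`m((a₀,n₀),(a₁,n₁)) = ((a₀+a₁)/2, (n₀+n₁)/(2cosh(a₀−a₁)))`, the
double-triangle map `Φ(x,y,z) = (m(x,y), m(y,z), m(z,x))` is a bijection. -/
theorem stmt_9
    (s : ℝ × ℝ → ℝ × ℝ → ℝ × ℝ)
    (hs : ∀ x y, s x y = (2 * x.1 - y.1, 2 * Real.cosh (2 * (x.1 - y.1)) * x.2 - y.2))
    (m : ℝ × ℝ → ℝ × ℝ → ℝ × ℝ)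
    (hm : ∀ x y, m x y = ((x.1 + y.1) / 2, (x.2 + y.2) / (2 * Real.cosh (x.1 - y.1))))
    (hmid : ∀ x y, s (m x y) x = y)
    (Φ : (ℝ × ℝ) × (ℝ × ℝ) × (ℝ × ℝ) → (ℝ × ℝ) × (ℝ × ℝ) × (ℝ × ℝ))
    (hΦ : ∀ p, Φ p = (m p.1 p.2.1, m p.2.1 p.2.2, m p.2.2 p.1)) :
    Function.Bijective Φ := by
  constructor
  · rintro ⟨⟨a, n⟩, ⟨b, p⟩, ⟨c, q⟩⟩ ⟨⟨a', n'⟩, ⟨b', p'⟩, ⟨c', q'⟩⟩ h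
    simp only [hΦ, hm, Prod.mk.injEq] at h
    obtain ⟨⟨h1, h2⟩, ⟨h3, h4⟩, ⟨h5, h6⟩⟩ := h
    obtain rfl : a = a' := by linarith
    obtain rfl : b = b' := by linarith
    obtain rfl : c = c' := by linarith
    have k : ∀ t : ℝ, 2 * Real.cosh t ≠ 0 := fun t => by
      have := Real.cosh_pos t
      positivity
    rw [div_left_inj' (k _)] at h2 h4 h6
    obtain rfl : n = n' := by linarith
    obtain rfl : p = p' := by linarith
    obtain rfl : q = q' := by linarith
    rfl
  · rintro ⟨⟨a, n⟩, ⟨b, p⟩, ⟨c, q⟩⟩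
    have k : ∀ t : ℝ, 2 * Real.cosh t ≠ 0 := fun t => by
      have := Real.cosh_pos t
      positivity
    let P := n * (2 * Real.cosh ((a + c - b) - (a + b - c)))
    let Q := p * (2 * Real.cosh ((a + b - c) - (b + c - a)))
    let R := q * (2 * Real.cosh ((b + c - a) - (a + c - b)))
    refine ⟨((a + c - b, (P + R - Q) / 2), (a + b - c, (P + Q - R) / 2),
      (b + c - a, (Q + R - P) / 2)), ?_⟩
    simp only [hΦ, hm, Prod.mk.injEq]
    refine ⟨⟨by ring, ?_⟩, ⟨by ring, ?_⟩, ⟨by ring, ?_⟩⟩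
    · rw [div_eq_iff (k _)]
      change _ = P
      ring
    · rw [div_eq_iff (k _)]
      change _ = Q
      ring
    · rw [div_eq_iff (k _)]
      change _ = R
      ring
end

section
/- Let V be a real vector space and ω₀ an alternating bilinear form on V. On S := ℝ × V × ℝ define s_{(a,v,t)}(a',v',t') := (2a−a', 2·cosh(a−a')·v − v', 2·cosh(2a−2a')·t + ω₀(v,v')·sinh(a−a') − t'). Then for all x, y ∈ S: (a) s_x ∘ s_x = id; (b) s_x ∘ s_y ∘ s_x = s_{s_x(y)}; and (c) when V = ℝ^{2d}, each s_x preserves the Lebesgue measure on ℝ^{2d+2}. Hence s defines a symmetric space structure on the elementary normal j-group S. -/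
open MeasureTheory

/-- On `S = ℝ × V × ℝ` with
`s_{(a,v,t)}(a',v',t') = (2a−a', 2cosh(a−a')v − v',
 2cosh(2a−2a')t + ω₀(v,v')sinh(a−a') − t')`,
each `s_x` is involutive and `s_x ∘ s_y ∘ s_x = s_{s_x y}`; moreover when
`V = ℝ^{2d}` each `s_x` preserves the Lebesgue measure on `ℝ^{2d+2}`. Hence
`s` defines a symmetric space structure on the elementary normal j-group. -/
theorem stmt_10 {V : Type*} [AddCommGroup V] [Module ℝ V]
    (ω : V →ₗ[ℝ] V →ₗ[ℝ] ℝ) (hω : ∀ v w, ω v w = -ω w v)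
    (s : ℝ × V × ℝ → ℝ × V × ℝ → ℝ × V × ℝ)
    (hs : ∀ x y, s x y =
      (2 * x.1 - y.1,
       (2 * Real.cosh (x.1 - y.1)) • x.2.1 - y.2.1,
       2 * Real.cosh (2 * x.1 - 2 * y.1) * x.2.2
         + ω x.2.1 y.2.1 * Real.sinh (x.1 - y.1) - y.2.2)) :
    (∀ x y, s x (s x y) = y) ∧
    (∀ x y z, s x (s y (s x z)) = s (s x y) z) ∧
    (∀ (d : ℕ) (ω' : (Fin (2 * d) → ℝ) →ₗ[ℝ] (Fin (2 * d) → ℝ) →ₗ[ℝ] ℝ),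
      (∀ v w, ω' v w = -ω' w v) →
      ∀ x : ℝ × (Fin (2 * d) → ℝ) × ℝ,
        MeasurePreserving
          (fun y : ℝ × (Fin (2 * d) → ℝ) × ℝ =>
            (2 * x.1 - y.1,
             (2 * Real.cosh (x.1 - y.1)) • x.2.1 - y.2.1,
             2 * Real.cosh (2 * x.1 - 2 * y.1) * x.2.2
               + ω' x.2.1 y.2.1 * Real.sinh (x.1 - y.1) - y.2.2))
          volume volume) := by
  have h0 : ∀ v, ω v v = 0 := fun v => by linarith [hω v v]
  refine ⟨?_, ?_, ?_⟩
  · rintro ⟨a, v, t⟩ ⟨b, w, u⟩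
    simp only [hs]
    have e1 : a - (2 * a - b) = -(a - b) := by ring
    have e2 : 2 * a - 2 * (2 * a - b) = -(2 * a - 2 * b) := by ring
    simp only [e1, e2, Real.cosh_neg, Real.sinh_neg, map_sub, map_smul, h0, smul_eq_mul]
    refine Prod.ext ?_ (Prod.ext ?_ ?_)
    · simp
    · simp
    · simp
  · rintro ⟨a, v, t⟩ ⟨b, w, u⟩ ⟨c, r, q⟩
    simp only [hs]
    obtain ⟨A, rfl⟩ : ∃ A, a = b + A := ⟨a - b, by ring⟩
    obtain ⟨B, rfl⟩ : ∃ B, b = c + B := ⟨b - c, by ring⟩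
    have hc1 : ∀ x y : ℝ, ∀ E : ℝ, Real.exp x = E → y = x →
        Real.cosh y = (E + E⁻¹) / 2 := by
      rintro x y E rfl rfl
      rw [Real.cosh_eq, Real.exp_neg]
    have hs1 : ∀ x y : ℝ, ∀ E : ℝ, Real.exp x = E → y = x →
        Real.sinh y = (E - E⁻¹) / 2 := by
      rintro x y E rfl rfl
      rw [Real.sinh_eq, Real.exp_neg]
    have hexp : ∀ m n : ℤ, Real.exp (m * A + n * B) = Real.exp A ^ m * Real.exp B ^ n := by
      intro m n
      rw [Real.exp_add, mul_comm _ A, mul_comm _ B, Real.exp_mul, Real.exp_mul, Real.rpow_intCast, Real.rpow_intCast]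
    have hC : ∀ (m n : ℤ) (y : ℝ), y = m * A + n * B →
        Real.cosh y = (Real.exp A ^ m * Real.exp B ^ n + (Real.exp A ^ m * Real.exp B ^ n)⁻¹) / 2 :=
      fun m n y h => hc1 _ _ _ (hexp m n) h
    have hS : ∀ (m n : ℤ) (y : ℝ), y = m * A + n * B →
        Real.sinh y = (Real.exp A ^ m * Real.exp B ^ n - (Real.exp A ^ m * Real.exp B ^ n)⁻¹) / 2 :=
      fun m n y h => hs1 _ _ _ (hexp m n) h
    have heA := (Real.exp_pos A).ne'
    have heB := (Real.exp_pos B).ne'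
    have w1 := hω w v
    have e1 : c + B + A - c = (1:ℤ) * A + (1:ℤ) * B := by push_cast; ring
    have e2 : c + B - (2 * (c + B + A) - c) = (-2:ℤ) * A + (-1:ℤ) * B := by push_cast; ring
    have e3 : c + B + A - (2 * (c + B) - (2 * (c + B + A) - c)) = (3:ℤ) * A + (1:ℤ) * B := by
      push_cast; ring
    have e4 : c + B + A - (c + B) = (1:ℤ) * A + (0:ℤ) * B := by push_cast; ring
    have e5 : 2 * (c + B + A) - (c + B) - c = (2:ℤ) * A + (1:ℤ) * B := by push_cast; ring
    have f1 : 2 * (c + B + A) - 2 * c = (2:ℤ) * A + (2:ℤ) * B := by push_cast; ring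
    have f2 : 2 * (c + B) - 2 * (2 * (c + B + A) - c) = (-4:ℤ) * A + (-2:ℤ) * B := by
      push_cast; ring
    have f3 : 2 * (c + B + A) - 2 * (2 * (c + B) - (2 * (c + B + A) - c))
        = (6:ℤ) * A + (2:ℤ) * B := by push_cast; ring
    have f4 : 2 * (c + B + A) - 2 * (c + B) = (2:ℤ) * A + (0:ℤ) * B := by push_cast; ring
    have f5 : 2 * (2 * (c + B + A) - (c + B)) - 2 * c = (4:ℤ) * A + (2:ℤ) * B := by
      push_cast; ring
    rw [hC _ _ _ e1, hC _ _ _ e2, hC _ _ _ e3, hC _ _ _ e4, hC _ _ _ e5,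
      hC _ _ _ f1, hC _ _ _ f2, hC _ _ _ f3, hC _ _ _ f4, hC _ _ _ f5,
      hS _ _ _ e1, hS _ _ _ e2, hS _ _ _ e3, hS _ _ _ e4, hS _ _ _ e5]
    generalize Real.exp A = E at *
    generalize Real.exp B = F at *
    refine Prod.ext ?_ (Prod.ext ?_ ?_)
    · simp only
      ring
    · simp only
      match_scalars <;> field_simp <;> ring
    · simp only [map_sub, map_smul, smul_eq_mul, LinearMap.sub_apply, LinearMap.smul_apply, h0, w1]
      field_simp
      ring
  · intro d ω' _ x
    have hcont : Continuous fun v => ω' x.2.1 v := LinearMap.continuous_of_finiteDimensional _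
    refine MeasurePreserving.skew_product (μa := volume) (μb := volume) (μc := volume)
      (μd := volume) (f := fun a : ℝ => 2 * x.1 - a)
      (g := fun (a : ℝ) (p : (Fin (2 * d) → ℝ) × ℝ) =>
        ((2 * Real.cosh (x.1 - a)) • x.2.1 - p.1,
             2 * Real.cosh (2 * x.1 - 2 * a) * x.2.2
               + ω' x.2.1 p.1 * Real.sinh (x.1 - a) - p.2))
      (Measure.measurePreserving_sub_left volume _) ?_ ?_
    · apply Continuous.measurable
      have := hcont.comp (continuous_fst.comp (continuous_snd (X := ℝ) (Y := (Fin (2 * d) → ℝ) × ℝ)))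
      simp only [Function.comp_def] at this
      unfold Function.uncurry
      fun_prop
    · refine Filter.Eventually.of_forall fun a => ?_
      refine (MeasurePreserving.skew_product (μa := volume) (μb := volume) (μc := volume)
        (μd := volume) (f := fun v : Fin (2 * d) → ℝ => (2 * Real.cosh (x.1 - a)) • x.2.1 - v)
        (g := fun v (t : ℝ) => 2 * Real.cosh (2 * x.1 - 2 * a) * x.2.2
               + ω' x.2.1 v * Real.sinh (x.1 - a) - t)
        (Measure.measurePreserving_sub_left volume _) ?_ ?_).map_eq
      · apply Continuous.measurable
        have := hcont.comp (continuous_fst (X := (Fin (2 * d) → ℝ)) (Y := ℝ))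
        simp only [Function.comp_def] at this
        unfold Function.uncurry
        fun_prop
      · exact Filter.Eventually.of_forall fun v => (Measure.measurePreserving_sub_left volume _).map_eq
end

section
/- Let V be a real vector space and ω₀ an alternating bilinear form on V. On S := ℝ × V × ℝ define the group law (a,v,t)·(a',v',t') := (a+a', e^{−a'}v + v', e^{−2a'}t + t' + (1/2)e^{−a'}ω₀(v,v')) and the symmetry s_{(a,v,t)}(a',v',t') := (2a−a', 2cosh(a−a')v − v', 2cosh(2a−2a')t + ω₀(v,v')sinh(a−a') − t'). Then: (i) for all x, y, z ∈ S, x·s_y(z) = s_{x·y}(x·z), i.e. every left translation is an automorphism of (S,s); (ii) if A : V → V is a linear map with ω₀(Av, Aw) = ω₀(v,w) for all v,w, then R_A(a,v,t) := (a, Av, t) satisfies R_A(x·y) = R_A(x)·R_A(y) and R_A(s_x(y)) = s_{R_A(x)}(R_A(y)) for all x,y ∈ S. -/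
/-- On the elementary normal j-group `S = ℝ × V × ℝ`, left translations for the
group law `(a,v,t)·(a',v',t') = (a+a', e^{−a'}v+v', e^{−2a'}t+t'+½e^{−a'}ω₀(v,v'))`
are automorphisms of the symmetric space structure `s`, and every symplectic
linear map `A` of `(V, ω₀)` induces an automorphism `R_A(a,v,t) = (a, Av, t)`
of both the group and the symmetric space structures. -/
theorem stmt_11 {V : Type*} [AddCommGroup V] [Module ℝ V]
    (ω : V →ₗ[ℝ] V →ₗ[ℝ] ℝ) (hω : ∀ v w, ω v w = -ω w v)
    (mul : ℝ × V × ℝ → ℝ × V × ℝ → ℝ × V × ℝ)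
    (hmul : ∀ p q, mul p q =
      (p.1 + q.1,
       Real.exp (-q.1) • p.2.1 + q.2.1,
       Real.exp (-(2 * q.1)) * p.2.2 + q.2.2
         + (1 / 2) * Real.exp (-q.1) * ω p.2.1 q.2.1))
    (s : ℝ × V × ℝ → ℝ × V × ℝ → ℝ × V × ℝ)
    (hs : ∀ x y, s x y =
      (2 * x.1 - y.1,
       (2 * Real.cosh (x.1 - y.1)) • x.2.1 - y.2.1,
       2 * Real.cosh (2 * x.1 - 2 * y.1) * x.2.2
         + ω x.2.1 y.2.1 * Real.sinh (x.1 - y.1) - y.2.2))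
    (A : V →ₗ[ℝ] V) (hA : ∀ v w, ω (A v) (A w) = ω v w)
    (RA : ℝ × V × ℝ → ℝ × V × ℝ)
    (hRA : ∀ p, RA p = (p.1, A p.2.1, p.2.2)) :
    (∀ x y z : ℝ × V × ℝ, mul x (s y z) = s (mul x y) (mul x z)) ∧
    (∀ x y : ℝ × V × ℝ, RA (mul x y) = mul (RA x) (RA y)) ∧
    (∀ x y : ℝ × V × ℝ, RA (s x y) = s (RA x) (RA y)) := by
  have hself : ∀ v, ω v v = 0 := fun v => by have := hω v v; linarith
  refine ⟨?_, ?_, ?_⟩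
  · rintro ⟨a, u, r⟩ ⟨b, v, t⟩ ⟨c, w, q⟩
    have hE := Real.exp_ne_zero b
    have hF := Real.exp_ne_zero c
    have e1 : Real.exp (-(2 * b - c)) = Real.exp c / Real.exp b ^ 2 := by
      rw [← Real.exp_nat_mul, ← Real.exp_sub]; congr 1; push_cast; ring
    have e2 : Real.exp (-(2 * (2 * b - c))) = Real.exp c ^ 2 / Real.exp b ^ 4 := by
      rw [← Real.exp_nat_mul, ← Real.exp_nat_mul, ← Real.exp_sub]; congr 1; push_cast; ring
    have e3 : ∀ x : ℝ, Real.exp (-(2 * x)) = 1 / Real.exp x ^ 2 := by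
      intro x
      rw [← Real.exp_nat_mul, one_div, ← Real.exp_neg]; congr 1
    have c1 : Real.cosh (b - c) = (Real.exp b / Real.exp c + Real.exp c / Real.exp b) / 2 := by
      rw [Real.cosh_eq, neg_sub, Real.exp_sub, Real.exp_sub]
    have s1 : Real.sinh (b - c) = (Real.exp b / Real.exp c - Real.exp c / Real.exp b) / 2 := by
      rw [Real.sinh_eq, neg_sub, Real.exp_sub, Real.exp_sub]
    have c2 : Real.cosh (2 * b - 2 * c)
        = (Real.exp b ^ 2 / Real.exp c ^ 2 + Real.exp c ^ 2 / Real.exp b ^ 2) / 2 := by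
      rw [Real.cosh_eq, neg_sub, Real.exp_sub, Real.exp_sub, ← Real.exp_nat_mul,
        ← Real.exp_nat_mul]; norm_num
    have d1 : a + b - (a + c) = b - c := by ring
    have d2 : 2 * (a + b) - 2 * (a + c) = 2 * b - 2 * c := by ring
    simp only [hmul, hs, d1, d2, e1, e2, e3, c1, s1, c2, Real.exp_neg, Prod.mk.injEq]
    refine ⟨by ring, ?_, ?_⟩
    · match_scalars <;> field_simp <;> ring
    · simp only [map_add, map_sub, map_smul, LinearMap.add_apply, LinearMap.smul_apply,
        smul_eq_mul, hself, hω v u]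
      field_simp
      ring
  · intro x y
    simp [hmul, hRA, hA]
  · intro x y
    simp [hs, hRA, hA]
end

section
/- Let V be a real vector space and ω₀ an alternating bilinear form on V. On S := ℝ × V × ℝ with symmetry s_{(a,v,t)}(a',v',t') := (2a−a', 2cosh(a−a')v − v', 2cosh(2a−2a')t + ω₀(v,v')sinh(a−a') − t'), fix x₀ = (a₀,v₀,t₀) ∈ S. Then for every x = (a,v,t) ∈ S the point m := ( (a+a₀)/2 , (v+v₀)/(2cosh((a−a₀)/2)) , (t+t₀)/(2cosh(a−a₀)) − ω₀(v,v₀)·sinh((a−a₀)/2)/(4cosh(a−a₀)cosh((a−a₀)/2)) ) satisfies s_m(x₀) = x. In other words, the partial map s^{x₀} : m ↦ s_m(x₀) is surjective with explicit right inverse given by the above formula, so (S,s) admits a midpoint map. -/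
/-- Explicit midpoint map on the elementary normal j-group: for the symmetric
space structure `s` on `S = ℝ × V × ℝ` and any `x₀ = (a₀,v₀,t₀)`, every
`x = (a,v,t)` is of the form `s_m(x₀)` for the explicitly given midpoint `m`;
i.e. the partial map `m ↦ s_m(x₀)` is surjective with explicit right inverse. -/
theorem stmt_12 {V : Type*} [AddCommGroup V] [Module ℝ V]
    (ω : V →ₗ[ℝ] V →ₗ[ℝ] ℝ) (hω : ∀ v w, ω v w = -ω w v)
    (s : ℝ × V × ℝ → ℝ × V × ℝ → ℝ × V × ℝ)
    (hs : ∀ x y, s x y =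
      (2 * x.1 - y.1,
       (2 * Real.cosh (x.1 - y.1)) • x.2.1 - y.2.1,
       2 * Real.cosh (2 * x.1 - 2 * y.1) * x.2.2
         + ω x.2.1 y.2.1 * Real.sinh (x.1 - y.1) - y.2.2))
    (a₀ : ℝ) (v₀ : V) (t₀ : ℝ) :
    ∀ (a : ℝ) (v : V) (t : ℝ),
      s ((a + a₀) / 2,
         (2 * Real.cosh ((a - a₀) / 2))⁻¹ • (v + v₀),
         (t + t₀) / (2 * Real.cosh (a - a₀))
           - ω v v₀ * Real.sinh ((a - a₀) / 2)
             / (4 * Real.cosh (a - a₀) * Real.cosh ((a - a₀) / 2)))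
        (a₀, v₀, t₀) = (a, v, t) := by
  intro a v t
  have h0 : ω v₀ v₀ = 0 := by linarith [hω v₀ v₀]
  have e1 : (a + a₀) / 2 - a₀ = (a - a₀) / 2 := by ring
  have e2 : 2 * ((a + a₀) / 2) - 2 * a₀ = a - a₀ := by ring
  have c1 : Real.cosh ((a - a₀) / 2) ≠ 0 := (Real.cosh_pos _).ne'
  have c2 : Real.cosh (a - a₀) ≠ 0 := (Real.cosh_pos _).ne'
  rw [hs]
  simp only [e1, e2, Prod.mk.injEq]
  refine ⟨by ring, ?_, ?_⟩
  · rw [smul_smul, mul_inv_cancel₀ (mul_ne_zero two_ne_zero c1), one_smul, add_sub_cancel_right]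
  · simp only [map_smul, map_add, LinearMap.smul_apply, LinearMap.add_apply, h0, smul_eq_mul]
    generalize Real.cosh ((a - a₀) / 2) = x at *
    generalize Real.cosh (a - a₀) = y at *
    generalize Real.sinh ((a - a₀) / 2) = z at *
    field_simp
    ring
end

section
/- Let θ ≠ 0 and λ ∈ ℝ. Let H₀ := L²(ℝ; ℂ) (Lebesgue measure) and H_λ := L²(ℝ, e^{2λa}da; ℂ), and for x = (a,n) ∈ ℝ² let U_{θ,λ}(x) be the operator (U_{θ,λ}(a,n)φ)(a₀) := e^{−λa + (i/θ)e^{2(a−a₀)}n}·φ(a₀−a). Then the multiplication operator m_λ : φ ↦ (a ↦ e^{−λa}·φ(a)) is a surjective linear isometry from H₀ onto H_λ, and it intertwines the representations: m_λ ∘ U_{θ,0}(x) = U_{θ,λ}(x) ∘ m_λ for every x ∈ ℝ². Hence U_{θ,0} and U_{θ,λ} are unitarily equivalent representations of the ax+b group. -/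
open MeasureTheory

/-- The multiplication operator `m_λ : φ ↦ (a ↦ e^{−λa} φ(a))` is a linear,
surjective isometry from `H₀ = L²(ℝ; ℂ)` onto `H_λ = L²(ℝ, e^{2λa}da; ℂ)`
which intertwines the representations `U_{θ,0}` and `U_{θ,λ}` of the `ax+b`
group: `m_λ ∘ U_{θ,0}(x) = U_{θ,λ}(x) ∘ m_λ`. -/
theorem stmt_14 (θ lam : ℝ) (hθ : θ ≠ 0)
    (μ : ℝ → Measure ℝ)
    (hμ : ∀ l, μ l = volume.withDensity fun a => ENNReal.ofReal (Real.exp (2 * l * a)))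
    (U : ℝ → ℝ × ℝ → (ℝ → ℂ) → (ℝ → ℂ))
    (hU : ∀ l p φ a₀, U l p φ a₀ =
      Complex.exp ((-(l * p.1) : ℝ)
        + Complex.I / (θ : ℂ) * (Real.exp (2 * (p.1 - a₀)) : ℝ) * (p.2 : ℝ))
        * φ (a₀ - p.1))
    (ml : (ℝ → ℂ) → (ℝ → ℂ))
    (hml : ∀ φ a, ml φ a = (Real.exp (-(lam * a)) : ℝ) * φ a) :
    (∀ (c : ℂ) (φ ψ : ℝ → ℂ),
      ml (fun a => c * φ a + ψ a) = fun a => c * ml φ a + ml ψ a) ∧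
    (∀ φ : ℝ → ℂ,
      ∫⁻ a, (‖ml φ a‖₊ : ENNReal) ^ 2 ∂(μ lam)
        = ∫⁻ a, (‖φ a‖₊ : ENNReal) ^ 2 ∂(μ 0)) ∧
    (∀ ψ : ℝ → ℂ, ∃ φ : ℝ → ℂ, ml φ = ψ) ∧
    (∀ (x : ℝ × ℝ) (φ : ℝ → ℂ), ml (U 0 x φ) = U lam x (ml φ)) := by
  have key : ∀ (l : ℝ) (f : ℝ → ENNReal), ∫⁻ a, f a ∂(μ l)
      = ∫⁻ a, ENNReal.ofReal (Real.exp (2 * l * a)) * f a := by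
    intro l f
    rw [hμ, lintegral_withDensity_eq_lintegral_mul_non_measurable]
    · rfl
    · fun_prop
    · exact Filter.Eventually.of_forall fun a => ENNReal.ofReal_lt_top
  refine ⟨?_, ?_, ?_, ?_⟩
  · intro c φ ψ
    funext a
    simp only [hml]
    ring
  · intro φ
    rw [key, key]
    refine lintegral_congr fun a => ?_
    have h1 : (‖ml φ a‖₊ : ENNReal) = ENNReal.ofReal (Real.exp (-(lam * a))) * ‖φ a‖₊ := by
      rw [hml, nnnorm_mul, ENNReal.coe_mul]
      congr 1
      rw [← enorm_eq_nnnorm, ← ofReal_norm_eq_enorm, Complex.norm_real, Real.norm_eq_abs,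
        abs_of_pos (Real.exp_pos _)]
    rw [h1, mul_pow, ← mul_assoc, ← ENNReal.ofReal_pow (Real.exp_pos _).le,
      ← ENNReal.ofReal_mul (Real.exp_pos _).le, ← Real.exp_nat_mul, ← Real.exp_add]
    congr 3
    push_cast
    ring_nf
  · intro ψ
    refine ⟨fun a => (Real.exp (lam * a) : ℝ) * ψ a, ?_⟩
    funext a
    rw [hml, ← mul_assoc, ← Complex.ofReal_mul, ← Real.exp_add]
    simp
  · intro x φ
    funext a
    simp only [hml, hU]
    rw [← mul_assoc, ← mul_assoc]
    congr 1
    rw [Complex.ofReal_exp (-(lam * a)), Complex.ofReal_exp (-(lam * (a - x.1))),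
      ← Complex.exp_add, ← Complex.exp_add]
    congr 1
    push_cast
    ring
end

section
/- For every n ∈ ℝ set r := arcsinh(n/2) and θ := arctan(e^{−r}), and set c₀ := e^{−r}·cos θ, s₀ := e^{r}·sin θ. Then c₀² + s₀² = 1 and one has the 2×2 real matrix identity [[1, n],[0, 1]] = [[cos θ, −sin θ],[sin θ, cos θ]] · [[e^{r}, 0],[0, e^{−r}]] · [[c₀, s₀],[−s₀, c₀]]. In particular every unipotent upper-triangular matrix in SL(2,ℝ) admits a K·A·K decomposition with diagonal part diag(e^{r}, e^{−r}) determined by n = 2·sinh(r). -/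
/-- Explicit KAK (Cartan) decomposition of the unipotent element
`[[1,n],[0,1]]` of `SL(2,ℝ)`: with `r = arcsinh(n/2)`, `θ = arctan(e^{−r})`,
`c₀ = e^{−r}cos θ` and `s₀ = e^{r}sin θ`, one has `c₀² + s₀² = 1` and
`[[1,n],[0,1]] = Rot(θ) · diag(e^{r}, e^{−r}) · [[c₀,s₀],[−s₀,c₀]]`. -/
theorem stmt_16 (n r θ c₀ s₀ : ℝ)
    (hr : r = Real.arsinh (n / 2))
    (hθ : θ = Real.arctan (Real.exp (-r)))
    (hc₀ : c₀ = Real.exp (-r) * Real.cos θ)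
    (hs₀ : s₀ = Real.exp r * Real.sin θ) :
    c₀ ^ 2 + s₀ ^ 2 = 1 ∧
    (!![1, n; 0, 1] : Matrix (Fin 2) (Fin 2) ℝ) =
      !![Real.cos θ, -Real.sin θ; Real.sin θ, Real.cos θ] *
        !![Real.exp r, 0; 0, Real.exp (-r)] *
        !![c₀, s₀; -s₀, c₀] := by
  have hpq : Real.exp r * Real.exp (-r) = 1 := by
    rw [← Real.exp_add]; simp
  have hn : Real.exp r - Real.exp (-r) = n := by
    have h := Real.sinh_arsinh (n / 2)
    rw [← hr, Real.sinh_eq] at h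
    linarith
  have hC : Real.cos θ ≠ 0 := by
    rw [hθ]; exact (Real.cos_arctan_pos _).ne'
  have hS : Real.sin θ = Real.exp (-r) * Real.cos θ := by
    have h : Real.tan θ = Real.exp (-r) := by rw [hθ, Real.tan_arctan]
    rw [← h, Real.tan_mul_cos hC]
  have h1 := Real.sin_sq_add_cos_sq θ
  have hs : s₀ = Real.cos θ := by
    rw [hs₀, hS, ← mul_assoc, hpq, one_mul]
  have hc : c₀ = Real.sin θ := by rw [hc₀, hS]
  rw [hs, hc]
  clear hs hc hs₀ hc₀ hr hθ
  generalize Real.sin θ = S at *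
  generalize Real.cos θ = C at *
  generalize Real.exp r = p at *
  generalize Real.exp (-r) = q at *
  subst hn hS
  refine ⟨h1, ?_⟩
  have h2 : C ^ 2 * (1 + q ^ 2) = 1 := by linarith
  ext i j
  fin_cases i <;> fin_cases j <;> simp [Matrix.mul_apply, Fin.sum_univ_two]
  · linear_combination (-1) * h2 - C ^ 2 * hpq
  · linear_combination (-(p - q)) * h2 + C ^ 2 * q * hpq
  · linear_combination (-(C ^ 2 * q)) * hpq
  · linear_combination (-1) * h2 - C ^ 2 * hpq
end

section
/- Let n ∈ ℝ, set r := arcsinh(n/2) and θ := arctan(e^{−r}), and let a ∈ ℝ. Consider the 2×2 real matrix g := [[cos θ, sin θ],[−sin θ, cos θ]] · [[e^{a}, 0],[0, e^{−a}]], and write g = [[α, β],[γ, δ]]. Then the N-component of the Iwasawa decomposition of g, namely the quantity β·δ + α·γ, equals −sinh(2a)/√(1 + n²/4). (Equivalently, sin(2θ) = 1/cosh(r) and β·δ + α·γ = −sin(2θ)·sinh(2a).) -/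
/-- With `r = arcsinh(n/2)`, `θ = arctan(e^{−r})` and
`g = [[cos θ, sin θ],[−sin θ, cos θ]] · diag(e^{a}, e^{−a}) = [[α,β],[γ,δ]]`,
the N-component `βδ + αγ` of the Iwasawa decomposition of `g` equals
`−sinh(2a)/√(1+n²/4)`; equivalently `sin(2θ) = 1/cosh r` and
`βδ + αγ = −sin(2θ)·sinh(2a)`. -/
theorem stmt_18 (n a r θ : ℝ)
    (hr : r = Real.arsinh (n / 2))
    (hθ : θ = Real.arctan (Real.exp (-r)))
    (g : Matrix (Fin 2) (Fin 2) ℝ)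
    (hg : g = !![Real.cos θ, Real.sin θ; -Real.sin θ, Real.cos θ] *
      !![Real.exp a, 0; 0, Real.exp (-a)]) :
    Real.sin (2 * θ) = 1 / Real.cosh r ∧
    g 0 1 * g 1 1 + g 0 0 * g 1 0 = -(Real.sin (2 * θ)) * Real.sinh (2 * a) ∧
    g 0 1 * g 1 1 + g 0 0 * g 1 0 = -Real.sinh (2 * a) / Real.sqrt (1 + n ^ 2 / 4) := by
  have h1 : Real.sin (2 * θ) = 1 / Real.cosh r := by
    have hpos : (0 : ℝ) < 1 + Real.exp (-r) ^ 2 := by positivity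
    have hs : Real.sqrt (1 + Real.exp (-r) ^ 2) ^ 2 = 1 + Real.exp (-r) ^ 2 :=
      Real.sq_sqrt hpos.le
    have e1 : Real.exp r * Real.exp (-r) = 1 := by
      rw [← Real.exp_add]; simp
    have hc : (0 : ℝ) < Real.exp r + Real.exp (-r) := by positivity
    have h2 : Real.sin (2 * θ) = 2 * Real.exp (-r) / (1 + Real.exp (-r) ^ 2) := by
      rw [Real.sin_two_mul, hθ, Real.sin_arctan, Real.cos_arctan, ← hs]
      have : Real.sqrt (1 + Real.exp (-r) ^ 2) ≠ 0 := (Real.sqrt_pos.mpr hpos).ne'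
      rw [hs]
      field_simp
      rw [hs]
    rw [h2, Real.cosh_eq, one_div_div, div_eq_div_iff hpos.ne' hc.ne']
    linear_combination 2 * e1
  have h2 : g 0 1 * g 1 1 + g 0 0 * g 1 0 = -(Real.sin (2 * θ)) * Real.sinh (2 * a) := by
    have e2 : Real.exp (2 * a) = Real.exp a ^ 2 := by
      rw [sq, ← Real.exp_add]; ring_nf
    have e3 : Real.exp (-(2 * a)) = Real.exp (-a) ^ 2 := by
      rw [sq, ← Real.exp_add]; ring_nf
    rw [Real.sin_two_mul, Real.sinh_eq, e2, e3, hg]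
    simp [Matrix.mul_apply, Fin.sum_univ_two]
    ring
  refine ⟨h1, h2, ?_⟩
  have h3 : Real.cosh r = Real.sqrt (1 + n ^ 2 / 4) := by
    rw [hr, Real.cosh_arsinh]; congr 1; ring
  rw [h2, h1, h3]
  ring
end
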